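/- Let G be a finite group, μ : G → ℂ, ν : G → ℝ nonnegative, and C > 0 with |μ(g)| ≤ C·ν(g) for all g ∈ G. Let A denote the convolution operator φ ↦ μ ∗ φ, and let E be a linear subspace of the mean-zero functions {φ : G → ℂ : ∑_x φ(x) = 0} that is invariant under both A and its adjoint A*. Suppose m ≥ 1 is such that every nonzero eigenvalue of the restriction of A*A to E has multiplicity at least m. Then the operator norm of the restriction of A to E satisfies ‖A|_E‖ ≤ C·(|G|·‖ν̃ ∗ ν‖₂² / m)^{1/4}. -/

import Mathlib

open scoped BigOperators ComplexConjugate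

/-- Convolution of real-valued functions on a finite group:
`(f ∗ g)(x) = ∑_y f(y)·g(y⁻¹x)`. -/
noncomputable def convR {G : Type*} [Group G] [Fintype G] (f g : G → ℝ) : G → ℝ :=
  fun x => ∑ y, f y * g (y⁻¹ * x)

/-- The ℓ² norm of a real-valued function. -/
noncomputable def norm2R {G : Type*} [Fintype G] (f : G → ℝ) : ℝ :=
  Real.sqrt (∑ x, |f x| ^ 2)

/-- `f̃(x) = f(x⁻¹)` for real-valued `f`. -/
def tildeR {G : Type*} [Group G] (f : G → ℝ) : G → ℝ := fun x => f x⁻¹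

/-- The convolution operator `A : φ ↦ μ ∗ φ`, as a linear endomorphism of
`L²(G) = EuclideanSpace ℂ G` (whose inner product realizes
`⟨f, g⟩ = ∑_x f(x)·conj(g(x))` up to the conjugation convention, which yields
the same adjoint and the same eigenvalue multiplicities). -/
noncomputable def convMap {G : Type*} [Group G] [Fintype G] (μ : G → ℂ) :
    EuclideanSpace ℂ G →ₗ[ℂ] EuclideanSpace ℂ G where
  toFun φ := WithLp.toLp 2 (fun x => ∑ y, μ y * φ (y⁻¹ * x))
  map_add' φ ψ := by
    ext x
    simp [mul_add, Finset.sum_add_distrib]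
  map_smul' c φ := by
    ext x
    simp [Finset.mul_sum, mul_comm, mul_left_comm]


/-- Hilbert-Schmidt bound for an orthonormal family of eigenvectors. -/
lemma hs_bound {G : Type*} [Fintype G] [DecidableEq G] {ι : Type*} [Fintype ι]
    (T : EuclideanSpace ℂ G →ₗ[ℂ] EuclideanSpace ℂ G) (hT : T.IsSymmetric)
    (b : ι → EuclideanSpace ℂ G) (hb : Orthonormal ℂ b) (l : ℝ)
    (hTb : ∀ i, T (b i) = (l : ℂ) • b i) :
    (Fintype.card ι : ℝ) * l ^ 2 ≤
      ∑ x, ∑ y, ‖inner ℂ (EuclideanSpace.single y (1:ℂ)) (T (EuclideanSpace.single x (1:ℂ)))‖ ^ 2 := by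
  have h1 : ∀ i, ‖T (b i)‖ ^ 2 = l ^ 2 := by
    intro i
    rw [hTb, norm_smul, hb.1 i]
    simp
  have h2 : ∀ v : EuclideanSpace ℂ G,
      ‖v‖ ^ 2 = ∑ y, ‖inner ℂ (EuclideanSpace.single y (1:ℂ)) v‖ ^ 2 := by
    intro v
    rw [EuclideanSpace.norm_sq_eq]
    refine Finset.sum_congr rfl fun y _ => ?_
    simp [EuclideanSpace.inner_single_left]
  calc (Fintype.card ι : ℝ) * l ^ 2 = ∑ i, ‖T (b i)‖ ^ 2 := by
        simp [h1]
    _ = ∑ i, ∑ x, ‖inner ℂ (b i) (T (EuclideanSpace.single x (1:ℂ)))‖ ^ 2 := by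
        refine Finset.sum_congr rfl fun i _ => ?_
        rw [h2]
        refine Finset.sum_congr rfl fun x _ => ?_
        rw [← hT, norm_inner_symm]
    _ = ∑ x, ∑ i, ‖inner ℂ (b i) (T (EuclideanSpace.single x (1:ℂ)))‖ ^ 2 := Finset.sum_comm
    _ ≤ ∑ x, ‖T (EuclideanSpace.single x (1:ℂ))‖ ^ 2 :=
        Finset.sum_le_sum fun x _ => hb.sum_inner_products_le _
    _ = _ := Finset.sum_congr rfl fun x _ => h2 _

lemma kernel_bound {G : Type*} [Group G] [Fintype G] [DecidableEq G]
    (μ : G → ℂ) (ν : G → ℝ)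
    (C : ℝ)
    (hdom : ∀ g, ‖μ g‖ ≤ C * ν g) (x y : G) :
    ‖inner ℂ (EuclideanSpace.single y (1:ℂ))
      ((LinearMap.adjoint (convMap μ) ∘ₗ convMap μ) (EuclideanSpace.single x (1:ℂ)))‖ ≤
      C ^ 2 * convR (tildeR ν) ν (y * x⁻¹) := by
  have key : ∀ x z : G, (convMap μ (EuclideanSpace.single x (1:ℂ))) z = μ (z * x⁻¹) := by
    intro x z
    simp only [convMap, LinearMap.coe_mk, AddHom.coe_mk]
    rw [Finset.sum_eq_single (z * x⁻¹)]
    · simp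
    · intro w _ hw
      have : w⁻¹ * z ≠ x := by
        rintro rfl
        apply hw
        group
      simp [this]
    · simp
  rw [LinearMap.comp_apply, LinearMap.adjoint_inner_right, PiLp.inner_apply]
  refine (norm_sum_le _ _).trans ?_
  have e : convR (tildeR ν) ν (y * x⁻¹) = ∑ z, ν (z * y⁻¹) * ν (z * x⁻¹) := by
    unfold convR tildeR
    refine Fintype.sum_equiv ((Equiv.inv G).trans (Equiv.mulRight y)) _ _ fun w => ?_
    simp [mul_assoc]
  rw [e, Finset.mul_sum]
  refine Finset.sum_le_sum fun z _ => ?_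
  rw [key, key]
  have := mul_le_mul (hdom (z * y⁻¹)) (hdom (z * x⁻¹)) (norm_nonneg _)
    ((norm_nonneg _).trans (hdom _))
  calc _ = ‖μ (z * y⁻¹)‖ * ‖μ (z * x⁻¹)‖ := by simp [mul_comm]
    _ ≤ _ := this
    _ = _ := by ring

lemma total_bound {G : Type*} [Group G] [Fintype G] [DecidableEq G]
    (μ : G → ℂ) (ν : G → ℝ)
    (C : ℝ)
    (hdom : ∀ g, ‖μ g‖ ≤ C * ν g) :
    ∑ x, ∑ y, ‖inner ℂ (EuclideanSpace.single y (1:ℂ))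
      ((LinearMap.adjoint (convMap μ) ∘ₗ convMap μ) (EuclideanSpace.single x (1:ℂ)))‖ ^ 2 ≤
      C ^ 4 * ((Fintype.card G : ℝ) * (norm2R (convR (tildeR ν) ν)) ^ 2) := by
  have h : (norm2R (convR (tildeR ν) ν)) ^ 2 = ∑ u, convR (tildeR ν) ν u ^ 2 := by
    unfold norm2R
    rw [Real.sq_sqrt (Finset.sum_nonneg fun _ _ => by positivity)]
    simp
  have : ∀ x : G, ∑ y, ‖inner ℂ (EuclideanSpace.single y (1:ℂ))
      ((LinearMap.adjoint (convMap μ) ∘ₗ convMap μ) (EuclideanSpace.single x (1:ℂ)))‖ ^ 2 ≤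
      C ^ 4 * (norm2R (convR (tildeR ν) ν)) ^ 2 := by
    intro x
    rw [h, Finset.mul_sum, ← Equiv.sum_comp (Equiv.mulRight x⁻¹) (fun u => C ^ 4 * convR (tildeR ν) ν u ^ 2)]
    refine Finset.sum_le_sum fun y _ => ?_
    refine (pow_le_pow_left₀ (norm_nonneg _) (kernel_bound μ ν C hdom x y) 2).trans ?_
    rw [Equiv.coe_mulRight]
    exact le_of_eq (by ring)
  refine (Finset.sum_le_sum fun x _ => this x).trans ?_
  rw [Finset.sum_const, nsmul_eq_mul, Finset.card_univ]
  exact le_of_eq (by ring)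

lemma le_of_sq_le_sq_aux {a b : ℝ} (h : a ^ 2 ≤ b ^ 2) (hb : 0 ≤ b) : a ≤ b :=
  (le_abs_self a).trans (abs_le_of_sq_le_sq h hb)

lemma eig_bound {G : Type*} [Fintype G] [DecidableEq G]
    (T : EuclideanSpace ℂ G →ₗ[ℂ] EuclideanSpace ℂ G) (hT : T.IsSymmetric)
    (W : Submodule ℂ (EuclideanSpace ℂ G)) (l : ℝ)
    (hTW : ∀ v ∈ W, T v = (l : ℂ) • v) :
    (Module.finrank ℂ W : ℝ) * l ^ 2 ≤
      ∑ x, ∑ y, ‖inner ℂ (EuclideanSpace.single y (1:ℂ)) (T (EuclideanSpace.single x (1:ℂ)))‖ ^ 2 := by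
  let b := stdOrthonormalBasis ℂ W
  have hb : Orthonormal ℂ (fun i => (b i : EuclideanSpace ℂ G)) :=
    b.orthonormal.comp_linearIsometry W.subtypeₗᵢ
  have hh := hs_bound T hT _ hb l (fun i => hTW _ (b i).2)
  rwa [Fintype.card_fin] at hh

lemma rayleigh_bound {F : Type*} [NormedAddCommGroup F] [InnerProductSpace ℂ F]
    [FiniteDimensional ℂ F] (S : F →ₗ[ℂ] F) (hS : S.IsSymmetric) (L : ℝ)
    (hL : ∀ l : ℝ, Module.End.HasEigenvalue S (l : ℂ) → l ≤ L) (φ : F) (r : ℝ)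
    (hr : (r : ℂ) = inner ℂ φ (S φ)) : r ≤ L * ‖φ‖ ^ 2 := by
  let b := hS.eigenvectorBasis rfl
  have e2 : inner ℂ φ (S φ) =
      ((∑ i, hS.eigenvalues rfl i * ‖inner ℂ (b i) φ‖ ^ 2 : ℝ) : ℂ) := by
    rw [← b.sum_inner_mul_inner]
    push_cast
    refine Finset.sum_congr rfl fun i _ => ?_
    have : inner ℂ (b i) (S φ) = (hS.eigenvalues rfl i : ℂ) * inner ℂ (b i) φ := by
      rw [← hS, hS.apply_eigenvectorBasis rfl i, inner_smul_left]
      simp [b]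
    rw [this, mul_left_comm, ← inner_conj_symm φ (b i), Complex.conj_mul']
  have e3 := Complex.ofReal_injective (hr.trans e2)
  rw [e3, ← b.sum_sq_norm_inner_right φ, Finset.mul_sum]
  exact Finset.sum_le_sum fun i _ => mul_le_mul_of_nonneg_right
    (hL _ (hS.hasEigenvalue_eigenvalues rfl i)) (sq_nonneg _)

/-- bound on the norm of a convolution operator restricted to an
invariant subspace `E` of mean-zero functions, in terms of a dominating
nonnegative measure `ν` and the minimal multiplicity `m` of nonzero
eigenvalues of `A*A` on `E`:
`‖A|_E‖ ≤ C·(|G|·‖ν̃ ∗ ν‖₂²/m)^{1/4}`. -/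
theorem opNorm_restrict_le
    {G : Type*} [Group G] [Fintype G]
    (μ : G → ℂ) (ν : G → ℝ) (hν : ∀ g, 0 ≤ ν g)
    (C : ℝ) (hC : 0 < C)
    (hdom : ∀ g, ‖μ g‖ ≤ C * ν g)
    (E : Submodule ℂ (EuclideanSpace ℂ G))
    (hE0 : ∀ φ ∈ E, (∑ x, φ x) = 0)
    (hAinv : ∀ φ ∈ E, convMap μ φ ∈ E)
    (hAadjinv : ∀ φ ∈ E, LinearMap.adjoint (convMap μ) φ ∈ E)
    (m : ℕ) (hm : 1 ≤ m)
    (hmult : ∀ lam : ℂ, lam ≠ 0 →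
      Module.End.HasEigenvalue
        ((LinearMap.adjoint (convMap μ) ∘ₗ convMap μ).restrict
          (fun φ hφ => hAadjinv _ (hAinv φ hφ))) lam →
      m ≤ Module.finrank ℂ
        (Module.End.eigenspace
          ((LinearMap.adjoint (convMap μ) ∘ₗ convMap μ).restrict
            (fun φ hφ => hAadjinv _ (hAinv φ hφ))) lam)) :
    ‖LinearMap.toContinuousLinearMap ((convMap μ).restrict hAinv)‖ ≤
      C * ((Fintype.card G : ℝ) * (norm2R (convR (tildeR ν) ν)) ^ 2 / (m : ℝ))
        ^ ((1 : ℝ) / 4) := by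
  classical
  set K : ℝ := (Fintype.card G : ℝ) * (norm2R (convR (tildeR ν) ν)) ^ 2 / (m : ℝ) with hK
  have hK0 : 0 ≤ K := by positivity
  have hm0 : (0 : ℝ) < m := by exact_mod_cast hm
  set T := LinearMap.adjoint (convMap μ) ∘ₗ convMap μ with hTdef
  have hTsymm : T.IsSymmetric := by
    intro u v
    simp only [hTdef, LinearMap.comp_apply, LinearMap.adjoint_inner_left,
      LinearMap.adjoint_inner_right]
  have hTE : ∀ φ ∈ E, T φ ∈ E := fun φ hφ => hAadjinv _ (hAinv φ hφ)
  have hS := hTsymm.restrict_invariant hTE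
  have heig : ∀ l : ℝ, Module.End.HasEigenvalue (T.restrict hTE) (l : ℂ) →
      l ≤ C ^ 2 * Real.sqrt K := by
    intro l hev
    by_cases h0 : l = 0
    · rw [h0]; positivity
    have hmle := hmult (l : ℂ) (by exact_mod_cast h0) hev
    let W := (Module.End.eigenspace (T.restrict hTE) (l : ℂ)).map E.subtype
    have hW : ∀ v ∈ W, T v = (l : ℂ) • v := by
      rintro v ⟨w, hw, rfl⟩
      exact congrArg (Subtype.val) (Module.End.mem_eigenspace_iff.1 hw)
    have hh := (eig_bound T hTsymm W l hW).trans (total_bound μ ν C hdom)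
    have hmle' : (m : ℝ) ≤ (Module.finrank ℂ W : ℝ) := by
      have : Module.finrank ℂ W = _ := Submodule.finrank_map_subtype_eq E _
      rw [this]
      exact_mod_cast hmle
    have h3 : (m : ℝ) * l ^ 2 ≤ C ^ 4 * ((Fintype.card G : ℝ) * (norm2R (convR (tildeR ν) ν)) ^ 2) :=
      (mul_le_mul_of_nonneg_right hmle' (sq_nonneg l)).trans hh
    have h4 : l ^ 2 ≤ C ^ 4 * K := by
      rw [hK, ← mul_div_assoc, le_div_iff₀ hm0]
      linarith
    refine le_of_sq_le_sq_aux ?_ (by positivity)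
    rw [mul_pow, Real.sq_sqrt hK0]
    linarith [show (C ^ 2) ^ 2 * K = C ^ 4 * K by ring]
  have hL : ∀ φ : E, ‖(convMap μ).restrict hAinv φ‖ ^ 2 ≤ C ^ 2 * Real.sqrt K * ‖φ‖ ^ 2 := by
    intro φ
    refine rayleigh_bound _ hS _ heig φ _ ?_
    rw [Submodule.coe_inner]
    simp only [LinearMap.restrict_coe_apply, hTdef, LinearMap.comp_apply,
      LinearMap.adjoint_inner_right]
    rw [inner_self_eq_norm_sq_to_K]
    simp
  have hfin : (C * K ^ ((1 : ℝ) / 4)) ^ 2 = C ^ 2 * Real.sqrt K := by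
    rw [mul_pow, ← Real.rpow_natCast (K ^ _), ← Real.rpow_mul hK0, Real.sqrt_eq_rpow]
    norm_num
  refine ContinuousLinearMap.opNorm_le_bound _ (by positivity) fun φ => ?_
  have := hL φ
  rw [← hfin, ← mul_pow] at this
  exact le_of_sq_le_sq_aux this (by positivity)
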